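/- Let p be a prime, V = (F_p)³, and G ⊆ SL(V) a finite subgroup such that F_p v₀ is a 1-dimensional G-submodule of V. Suppose the quotient V/F_p v₀ is an irreducible T(G)-module on which T(G) acts unfaithfully (i.e., the kernel of the induced map T(G) → GL(V/F_p v₀) is nontrivial). Then S(V)^{T(G)} is a polynomial ring: it is generated over F_p by three algebraically independent homogeneous invariants, of degrees 1, p² + p, and p³ − p². -/

import Mathlib

noncomputable section
open CategoryTheory Matrix MvPolynomial

universe u

/-- A module `M` over `R` has finite injective dimension iff the Ext functors
`Ext^i(-, M)` vanish for all sufficiently large `i`. -/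
def HasFiniteInjectiveDimension (R : Type u) [CommRing R] (M : ModuleCat.{u} R) : Prop :=
  ∃ n : ℕ, ∀ (N : ModuleCat.{u} R) (i : ℕ), n < i →
    Subsingleton (((Ext R (ModuleCat.{u} R) i).obj (Opposite.op N)).obj M)

/-- A commutative ring is Gorenstein if it is Noetherian and its localization at every
prime ideal has finite injective dimension over itself. -/
def IsGorensteinRing (R : Type u) [CommRing R] : Prop :=
  IsNoetherianRing R ∧ ∀ (P : Ideal R) [P.IsPrime],
    HasFiniteInjectiveDimension (Localization.AtPrime P)
      (ModuleCat.of (Localization.AtPrime P) (Localization.AtPrime P))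

/-- The substitution action of a matrix on polynomials: `X i ↦ ∑ j, M i j • X j`. -/
def polyAct {F : Type u} [CommSemiring F] {m : ℕ} (M : Matrix (Fin m) (Fin m) F) :
    MvPolynomial (Fin m) F →ₐ[F] MvPolynomial (Fin m) F :=
  MvPolynomial.aeval fun i => ∑ j, M i j • MvPolynomial.X j

/-- The subalgebra of polynomials invariant under a set of matrices. -/
def invariantAlg {F : Type u} [CommSemiring F] {m : ℕ} (S : Set (Matrix (Fin m) (Fin m) F)) :
    Subalgebra F (MvPolynomial (Fin m) F) where
  carrier := {f | ∀ M ∈ S, polyAct M f = f}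
  mul_mem' := fun hf hg => fun M hM => by rw [_root_.map_mul, hf M hM, hg M hM]
  add_mem' := fun hf hg => fun M hM => by rw [_root_.map_add, hf M hM, hg M hM]
  algebraMap_mem' := fun r => fun M hM => (polyAct M).commutes r

/-- The invariant ring `S(V)^G` for a subgroup `G` of `SL(m, F)`, where `S(V)` is realised
as the polynomial ring `F[X 0, …, X (m-1)]`. -/
def invariantRing {F : Type u} [Field F] {m : ℕ}
    (G : Subgroup (Matrix.SpecialLinearGroup (Fin m) F)) :
    Subalgebra F (MvPolynomial (Fin m) F) :=
  invariantAlg {M | ∃ g ∈ G, (g : Matrix (Fin m) (Fin m) F) = M}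

/-- A matrix `M` is a transvection if `rank (M - 1) = 1` and `(M - 1)² = 0`. -/
def IsTransvectionMat {F : Type u} [Field F] {m : ℕ} (M : Matrix (Fin m) (Fin m) F) : Prop :=
  (M - 1).rank = 1 ∧ (M - 1) * (M - 1) = 0

/-- `T(G)`: the subgroup generated by all transvections contained in `G`. -/
def transSubgroup {F : Type u} [Field F] {m : ℕ}
    (G : Subgroup (Matrix.SpecialLinearGroup (Fin m) F)) :
    Subgroup (Matrix.SpecialLinearGroup (Fin m) F) :=
  Subgroup.closure {g | g ∈ G ∧ IsTransvectionMat (g : Matrix (Fin m) (Fin m) F)}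

section PolyAct

variable {F : Type u} [Field F] {m : ℕ}

lemma polyAct_X (M : Matrix (Fin m) (Fin m) F) (i : Fin m) :
    polyAct M (X i) = ∑ j, M i j • X j := by
  simp [polyAct]

lemma polyAct_polyAct (M N : Matrix (Fin m) (Fin m) F) (f : MvPolynomial (Fin m) F) :
    polyAct M (polyAct N f) = polyAct (N * M) f := by
  have : (polyAct M).comp (polyAct N) = polyAct (N * M) := by
    refine MvPolynomial.algHom_ext fun i => ?_
    simp only [AlgHom.comp_apply, polyAct_X, map_sum, map_smul, Matrix.mul_apply,
      Finset.smul_sum, Finset.sum_smul, smul_smul]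
    exact Finset.sum_comm
  exact DFunLike.congr_fun this f

lemma polyAct_one (f : MvPolynomial (Fin m) F) : polyAct (1 : Matrix (Fin m) (Fin m) F) f = f := by
  have : polyAct (1 : Matrix (Fin m) (Fin m) F) = AlgHom.id F _ := by
    refine MvPolynomial.algHom_ext fun i => ?_
    simp [polyAct_X, Matrix.one_apply, ite_smul]
  rw [this, AlgHom.id_apply]

lemma isHomogeneous_polyAct (M : Matrix (Fin m) (Fin m) F) {f : MvPolynomial (Fin m) F} {n : ℕ}
    (hf : f.IsHomogeneous n) : (polyAct M f).IsHomogeneous n := by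
  have := hf.aeval (fun i => ∑ j, M i j • (X j : MvPolynomial (Fin m) F)) (n := 1) fun i => by
    refine IsHomogeneous.sum _ _ _ fun j _ => ?_
    rw [smul_eq_C_mul]
    exact isHomogeneous_C_mul_X _ _
  simpa [polyAct] using this

lemma homogeneousComponent_polyAct (M : Matrix (Fin m) (Fin m) F) (f : MvPolynomial (Fin m) F)
    (n : ℕ) : homogeneousComponent n (polyAct M f) = polyAct M (homogeneousComponent n f) := by
  classical
  conv_lhs => rw [← sum_homogeneousComponent f, map_sum, map_sum]
  simp only [homogeneousComponent_of_mem
    (isHomogeneous_polyAct M (homogeneousComponent_isHomogeneous _ f))]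
  rw [Finset.sum_ite_eq]
  split_ifs with h
  · rfl
  · rw [homogeneousComponent_eq_zero _ _ (by simpa using h), map_zero]

/-- A subalgebra `A` of an invariant algebra is everything as soon as each homogeneous invariant is
congruent to an element of `A` of the same degree modulo a fixed invariant of positive degree. -/
lemma invariantAlg_le_of_forall_dvd_sub {S : Set (Matrix (Fin m) (Fin m) F)}
    {A : Subalgebra F (MvPolynomial (Fin m) F)} (hA : A ≤ invariantAlg S)
    {t : MvPolynomial (Fin m) F} (ht : t ∈ A) (ht0 : 0 < t.totalDegree)
    (hstep : ∀ n f, f ∈ invariantAlg S → f.IsHomogeneous n →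
      ∃ a ∈ A, a.IsHomogeneous n ∧ t ∣ f - a) : invariantAlg S ≤ A := by
  have htne : t ≠ 0 := by rintro rfl; simp at ht0
  have key : ∀ n, ∀ f ∈ invariantAlg S, f.totalDegree < n → f ∈ A := by
    intro n
    induction n with
    | zero => intro f _ h; omega
    | succ n ih =>
      intro f hf hn
      rw [← sum_homogeneousComponent f]
      refine Subalgebra.sum_mem _ fun i hi => ?_
      have hfi : homogeneousComponent i f ∈ invariantAlg S := fun M hM => by
        rw [← homogeneousComponent_polyAct, hf M hM]
      have hhom := homogeneousComponent_isHomogeneous i f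
      obtain ⟨a, haA, ha, h, hh⟩ := hstep i _ hfi hhom
      rw [sub_eq_iff_eq_add] at hh
      rw [hh]
      refine add_mem (mul_mem ht ?_) haA
      by_cases h0 : h = 0
      · rw [h0]; exact zero_mem _
      apply ih
      · have hth : t * h ∈ invariantAlg S := by
          rw [eq_sub_of_add_eq hh.symm]
          exact sub_mem hfi (hA haA)
        intro M hM
        have := hth M hM
        rw [map_mul, hA ht M hM] at this
        exact mul_left_cancel₀ htne this
      · have h1 : (t * h).totalDegree ≤ i := by
          rw [eq_sub_of_add_eq hh.symm]
          exact (hhom.sub ha).totalDegree_le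
        rw [totalDegree_mul_of_isDomain htne h0] at h1
        rw [Finset.mem_range] at hi
        omega
  exact fun f hf => key _ f hf (Nat.lt_succ_self _)

end PolyAct

section SetFirstZero

variable {F : Type u} [Field F] {m : ℕ}

/-- The substitution `X 0 ↦ 0`, `X (i + 1) ↦ X i`. -/
def setFirstZero (F : Type u) [Field F] (m : ℕ) :
    MvPolynomial (Fin (m + 1)) F →ₐ[F] MvPolynomial (Fin m) F :=
  MvPolynomial.aeval (Fin.cons 0 X)

@[simp] lemma setFirstZero_X_zero : setFirstZero F m (X 0) = 0 := by
  simp [setFirstZero]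

@[simp] lemma setFirstZero_X_succ (i : Fin m) : setFirstZero F m (X i.succ) = X i := by
  simp [setFirstZero]

lemma X_zero_dvd_sub_rename_setFirstZero (f : MvPolynomial (Fin (m + 1)) F) :
    X 0 ∣ f - rename Fin.succ (setFirstZero F m f) := by
  rw [← Ideal.mem_span_singleton, ← Ideal.Quotient.eq]
  change Ideal.Quotient.mkₐ F _ f =
    ((Ideal.Quotient.mkₐ F (Ideal.span {X 0})).comp
      ((rename Fin.succ).comp (setFirstZero F m))) f
  congr 1
  refine MvPolynomial.algHom_ext fun i => ?_
  induction i using Fin.cases with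
  | zero => simp
  | succ i => simp

lemma X_zero_dvd_iff (f : MvPolynomial (Fin (m + 1)) F) :
    X 0 ∣ f ↔ setFirstZero F m f = 0 := by
  constructor
  · rintro ⟨g, rfl⟩
    simp
  · intro h
    simpa [h] using X_zero_dvd_sub_rename_setFirstZero f

lemma isHomogeneous_setFirstZero {f : MvPolynomial (Fin (m + 1)) F} {n : ℕ}
    (hf : f.IsHomogeneous n) : (setFirstZero F m f).IsHomogeneous n := by
  have := hf.aeval (Fin.cons 0 X : Fin (m + 1) → MvPolynomial (Fin m) F) (n := 1) fun i => by
    induction i using Fin.cases with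
    | zero => simpa using isHomogeneous_zero _ _ _
    | succ i => simpa using isHomogeneous_X _ _
  simpa [setFirstZero] using this

lemma setFirstZero_pderiv (f : MvPolynomial (Fin (m + 1)) F) (i : Fin m) :
    setFirstZero F m (pderiv i.succ f) = pderiv i (setFirstZero F m f) := by
  induction f using MvPolynomial.induction_on with
  | C a => simp [setFirstZero]
  | add f g hf hg => simp [hf, hg]
  | mul_X f j hf =>
    simp only [Derivation.leibniz, map_add, smul_eq_mul, map_mul, hf]
    induction j using Fin.cases with
    | zero => simp [pderiv_X, (Fin.succ_ne_zero i).symm]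
    | succ j =>
      by_cases h : i = j
      · subst h; simp
      · simp [pderiv_X, Ne.symm h]

/-- First order Taylor expansion in one variable. -/
lemma exists_aeval_add_single_eq {σ : Type*} [DecidableEq σ] (j : σ) (t : MvPolynomial σ F)
    (f : MvPolynomial σ F) :
    ∃ r, aeval (fun i => X i + if i = j then t else 0) f = f + t * pderiv j f + t ^ 2 * r := by
  induction f using MvPolynomial.induction_on with
  | C a => exact ⟨0, by simp⟩
  | add f g hf hg =>
    obtain ⟨r, hr⟩ := hf
    obtain ⟨s, hs⟩ := hg
    exact ⟨r + s, by rw [map_add, hr, hs, map_add]; ring⟩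
  | mul_X f i hf =>
    obtain ⟨r, hr⟩ := hf
    rw [map_mul, hr, aeval_X]
    by_cases h : i = j
    · subst h
      refine ⟨pderiv i f + r * X i + r * t, ?_⟩
      simp only [if_true, Derivation.leibniz, smul_eq_mul, pderiv_X_self]
      ring
    · refine ⟨r * X i, ?_⟩
      simp only [if_neg h, Derivation.leibniz, smul_eq_mul, pderiv_X_of_ne h]
      ring

lemma dvd_pderiv_of_aeval_add_single_eq {σ : Type*} [DecidableEq σ] (j : σ)
    {t : MvPolynomial σ F} (ht : t ≠ 0) {f : MvPolynomial σ F}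
    (hf : aeval (fun i => X i + if i = j then t else 0) f = f) : t ∣ pderiv j f := by
  obtain ⟨r, hr⟩ := exists_aeval_add_single_eq j t f
  rw [hf] at hr
  refine ⟨-r, ?_⟩
  apply mul_left_cancel₀ ht
  linear_combination -hr

lemma algebraicIndependent_cons_of_map {S S' : Type*} [CommRing S] [IsDomain S] [Algebra F S]
    [CommRing S'] [Algebra F S'] (φ : S →ₐ[F] S') {t : S} (ht0 : t ≠ 0) (ht : φ t = 0)
    {s : Fin m → S} (hs : AlgebraicIndependent F fun i => φ (s i)) :
    AlgebraicIndependent F (Fin.cons t s : Fin (m + 1) → S) := by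
  rw [algebraicIndependent_iff]
  have key : ∀ n, ∀ q : MvPolynomial (Fin (m + 1)) F, q.totalDegree < n →
      aeval (Fin.cons t s : Fin (m + 1) → S) q = 0 → q = 0 := by
    intro n
    induction n with
    | zero => intro q h; omega
    | succ n ih =>
      intro q hq h
      have h1 : setFirstZero F m q = 0 := by
        rw [algebraicIndependent_iff] at hs
        apply hs
        have : (aeval fun i => φ (s i)).comp (setFirstZero F m) =
            φ.comp (aeval (Fin.cons t s : Fin (m + 1) → S)) := by
          refine MvPolynomial.algHom_ext fun i => ?_
          induction i using Fin.cases with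
          | zero => simp [ht]
          | succ i => simp
        have := DFunLike.congr_fun this q
        simpa [h] using this
      obtain ⟨r, rfl⟩ := (X_zero_dvd_iff q).2 h1
      by_cases hr : r = 0
      · simp [hr]
      rw [ih r ?_ ?_, mul_zero]
      · rw [totalDegree_mul_of_isDomain (X_ne_zero _) hr, totalDegree_X] at hq
        omega
      · simpa [ht0] using h
  exact fun q h => key _ q (Nat.lt_succ_self _) h

end SetFirstZero

section PthPowers

variable {p : ℕ} [Fact p.Prime] {σ : Type*}

/-- A homogeneous polynomial over `𝔽_p` all of whose partial derivatives vanish is the `p`-th power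
of a homogeneous polynomial. -/
lemma exists_eq_pow_of_pderiv_eq_zero {f : MvPolynomial σ (ZMod p)} {n : ℕ}
    (hf : f.IsHomogeneous n) (h : ∀ i, pderiv i f = 0) :
    ∃ g k, g.IsHomogeneous k ∧ f = g ^ p ∧ (f ≠ 0 → k * p = n) := by
  have hp : p.Prime := Fact.out
  have hdvd : ∀ d ∈ f.support, ∃ e : σ →₀ ℕ, d = p • e := by
    intro d hd
    have hi : ∀ i, p ∣ d i := by
      intro i
      by_cases h0 : d i = 0
      · simp [h0]
      have hc := congrArg (coeff (d - Finsupp.single i 1)) (h i)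
      have hd1 : d - Finsupp.single i 1 + Finsupp.single i 1 = d :=
        tsub_add_cancel_of_le (by simpa [Finsupp.single_le_iff] using Nat.one_le_iff_ne_zero.2 h0)
      rw [coeff_pderiv, hd1, coeff_zero] at hc
      rcases mul_eq_zero.1 hc with hc | hc
      · exact absurd hc (mem_support_iff.1 hd)
      · rw [← ZMod.natCast_eq_zero_iff]
        have : (d - Finsupp.single i 1 : σ →₀ ℕ) i + 1 = d i := by
          simp; omega
        rw [← this]
        exact_mod_cast hc
    refine ⟨d.mapRange (· / p) (by simp), ?_⟩
    ext i
    simp [Nat.mul_div_cancel' (hi i)]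
  choose! e he using hdvd
  refine ⟨∑ d ∈ f.support, monomial (e d) (coeff d f), n / p, ?_, ?_, ?_⟩
  · refine IsHomogeneous.sum _ _ _ fun d hd => isHomogeneous_monomial _ ?_
    have h1 := hf.degree_eq_sum_deg_support hd
    have h2 : Finsupp.degree d = p * (e d).degree := by
      conv_lhs => rw [he d hd]
      simp
    have h3 : Finsupp.degree d = n := by
      by_contra hne
      exact mem_support_iff.1 hd (hf.coeff_eq_zero hne)
    rw [← h3, h2, Nat.mul_div_cancel_left _ hp.pos]
  · rw [sum_pow_char]
    conv_lhs => rw [f.as_sum]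
    refine Finset.sum_congr rfl fun d hd => ?_
    rw [monomial_pow, ZMod.pow_card, ← he d hd]
  · intro hf0
    obtain ⟨d, hd⟩ := support_nonempty.2 hf0
    have h2 : Finsupp.degree d = p * (e d).degree := by
      conv_lhs => rw [he d hd]
      simp
    have h3 : Finsupp.degree d = n := by
      by_contra hne
      exact mem_support_iff.1 hd (hf.coeff_eq_zero hne)
    exact Nat.div_mul_cancel ⟨_, h3.symm.trans h2⟩

end PthPowers

section Dickson

variable (p : ℕ)

/-- The product, up to sign, of the linear forms in two variables over `𝔽_p` up to scalars. -/
def dicksonL : MvPolynomial (Fin 2) (ZMod p) := X 0 ^ p * X 1 - X 0 * X 1 ^ p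

/-- The Dickson invariant of degree `p² - p` in two variables over `𝔽_p`. -/
def dicksonD : MvPolynomial (Fin 2) (ZMod p) :=
  ∑ i ∈ Finset.range (p + 1), (X 0 ^ (p - 1)) ^ i * (X 1 ^ (p - 1)) ^ (p - i)

variable {p}

lemma isHomogeneous_dicksonL : (dicksonL p).IsHomogeneous (p + 1) := by
  refine IsHomogeneous.sub ?_ ?_
  · exact (isHomogeneous_X_pow _ _).mul (isHomogeneous_X _ _)
  · rw [add_comm]
    exact (isHomogeneous_X _ _).mul (isHomogeneous_X_pow _ _)

variable [hp : Fact p.Prime]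

lemma dicksonL_mul_dicksonD :
    dicksonL p * dicksonD p = X 0 ^ p ^ 2 * X 1 - X 0 * X 1 ^ p ^ 2 := by
  have h := (Commute.all (X 0 ^ (p - 1) : MvPolynomial (Fin 2) (ZMod p))
    (X 1 ^ (p - 1))).geom_sum₂_mul (p + 1)
  simp only [Nat.add_sub_cancel] at h
  have h1 : ∀ x : MvPolynomial (Fin 2) (ZMod p), x ^ p = x ^ (p - 1) * x := fun x => by
    rw [← pow_succ, Nat.sub_add_cancel hp.out.one_le]
  have h2 : ∀ x : MvPolynomial (Fin 2) (ZMod p), x ^ p ^ 2 = (x ^ (p - 1)) ^ (p + 1) * x :=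
    fun x => by
      rw [← pow_mul, ← pow_succ]
      congr 1
      obtain ⟨q, hq⟩ := Nat.exists_eq_add_of_le' hp.out.one_le
      rw [hq]; simp; ring
  rw [h2, h2, dicksonL, h1, h1, dicksonD]
  linear_combination (X 0 * X 1) * h

lemma isHomogeneous_dicksonD : (dicksonD p).IsHomogeneous ((p - 1) * p) := by
  refine IsHomogeneous.sum _ _ _ fun i hi => ?_
  have hi' : i ≤ p := Nat.lt_succ_iff.1 (Finset.mem_range.1 hi)
  have := ((isHomogeneous_X_pow (R := ZMod p) (0 : Fin 2) (p - 1)).pow i).mul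
    ((isHomogeneous_X_pow (R := ZMod p) (1 : Fin 2) (p - 1)).pow (p - i))
  rwa [← mul_add, Nat.add_sub_cancel' hi'] at this

lemma setFirstZero_X_one {F : Type u} [Field F] : setFirstZero F 1 (X 1) = X 0 :=
  setFirstZero_X_succ 0

lemma setFirstZero_dicksonL : setFirstZero (ZMod p) 1 (dicksonL p) = 0 := by
  simp [dicksonL, hp.out.ne_zero]

lemma setFirstZero_dicksonD : setFirstZero (ZMod p) 1 (dicksonD p) = X 0 ^ ((p - 1) * p) := by
  have h0 : p - 1 ≠ 0 := Nat.sub_ne_zero_of_lt hp.out.one_lt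
  rw [dicksonD, Finset.sum_range_succ', map_add, map_sum, Finset.sum_eq_zero, zero_add]
  · simp [setFirstZero_X_one, pow_mul]
  · intro i _
    simp [h0]

lemma dicksonL_ne_zero : dicksonL p ≠ 0 := by
  intro h
  have := congrArg (coeff (Finsupp.single 0 p + Finsupp.single 1 1)) h
  have h2 : p ≠ 1 := hp.out.ne_one
  have h3 : (X 0 ^ p * X 1 - X 0 * X 1 ^ p : MvPolynomial (Fin 2) (ZMod p)) =
    monomial (Finsupp.single 0 p + Finsupp.single 1 1) 1 -
      monomial (Finsupp.single 0 1 + Finsupp.single 1 p) 1 := by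
    rw [X_pow_eq_monomial, X_pow_eq_monomial]
    simp [X, monomial_mul]
  rw [dicksonL, h3, coeff_sub, coeff_monomial, coeff_monomial, if_pos rfl, if_neg,
    coeff_zero] at this
  · simp at this
  · intro h
    have := DFunLike.congr_fun h 0
    simp at this
    omega

lemma algebraicIndependent_dickson :
    AlgebraicIndependent (ZMod p) (Fin.cons (dicksonL p) ![dicksonD p] :
      Fin 2 → MvPolynomial (Fin 2) (ZMod p)) := by
  refine algebraicIndependent_cons_of_map (setFirstZero (ZMod p) 1) dicksonL_ne_zero
    setFirstZero_dicksonL ?_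
  rw [algebraicIndependent_unique_type_iff]
  have h1 := (transcendental_X (R := ZMod p) (0 : Fin 1)).pow
    (Nat.mul_pos (Nat.sub_pos_of_lt hp.out.one_lt) hp.out.pos)
  simpa [setFirstZero_dicksonD] using h1

end Dickson

section SpecialLinearInvariants

variable {p : ℕ} [hp : Fact p.Prime]

lemma polyAct_X_pow {m : ℕ} (M : Matrix (Fin m) (Fin m) (ZMod p)) (i : Fin m) (k : ℕ) :
    polyAct M (X i) ^ p ^ k = ∑ j, C (M i j) * X j ^ p ^ k := by
  rw [polyAct_X, sum_pow_char_pow]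
  refine Finset.sum_congr rfl fun j _ => ?_
  rw [smul_eq_C_mul, mul_pow, ← C_pow, ZMod.pow_card_pow]

lemma polyAct_alternating (M : Matrix (Fin 2) (Fin 2) (ZMod p)) (k : ℕ) :
    polyAct M (X 0 ^ p ^ k * X 1 - X 0 * X 1 ^ p ^ k) =
      C M.det * (X 0 ^ p ^ k * X 1 - X 0 * X 1 ^ p ^ k) := by
  simp only [map_sub, map_mul, map_pow]
  rw [polyAct_X_pow, polyAct_X_pow]
  simp only [polyAct_X, Fin.sum_univ_two, smul_eq_C_mul, Matrix.det_fin_two, map_sub, map_mul]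
  ring

lemma dicksonL_mem :
    dicksonL p ∈ invariantAlg {M : Matrix (Fin 2) (Fin 2) (ZMod p) | M.det = 1} := by
  intro M (hM : M.det = 1)
  have := polyAct_alternating M 1
  rw [pow_one, hM, C_1, one_mul] at this
  exact this

lemma dicksonD_mem :
    dicksonD p ∈ invariantAlg {M : Matrix (Fin 2) (Fin 2) (ZMod p) | M.det = 1} := by
  intro M (hM : M.det = 1)
  have h := polyAct_alternating M 2
  rw [hM, C_1, one_mul, ← dicksonL_mul_dicksonD, map_mul,
    dicksonL_mem M hM] at h
  exact mul_left_cancel₀ dicksonL_ne_zero h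

lemma prod_sub_smul_eq {K : Type*} [CommRing K] [IsDomain K] [Algebra (ZMod p) K] {x : K}
    (hx : x ≠ 0) (y : K) :
    ∏ a : ZMod p, (y - algebraMap (ZMod p) K a * x) = y ^ p - x ^ (p - 1) * y := by
  apply IsFractionRing.injective K (FractionRing K)
  have hx' : algebraMap K (FractionRing K) x ≠ 0 :=
    (map_ne_zero_iff _ (IsFractionRing.injective K (FractionRing K))).2 hx
  have hmonic : (Polynomial.X ^ p - Polynomial.X : Polynomial (ZMod p)).Monic :=
    Polynomial.monic_X_pow_sub (by simpa using hp.out.one_lt)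
  have hroots : (Polynomial.X ^ p - Polynomial.X : Polynomial (ZMod p)).roots =
      Finset.univ.val := by
    simpa [ZMod.card] using FiniteField.roots_X_pow_card_sub_X (ZMod p)
  have h := Polynomial.prod_multiset_X_sub_C_of_monic_of_roots_card_eq hmonic (by
    rw [hroots, FiniteField.X_pow_card_sub_X_natDegree_eq _ hp.out.one_lt]
    simp [ZMod.card])
  rw [hroots] at h
  replace h := congrArg (Polynomial.aeval
    (algebraMap K (FractionRing K) y / algebraMap K (FractionRing K) x)) h
  change Polynomial.aeval _ (∏ a : ZMod p, (Polynomial.X - Polynomial.C a)) = _ at h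
  simp only [map_prod, map_sub, Polynomial.aeval_X, Polynomial.aeval_C, map_pow] at h
  replace h := congrArg (algebraMap K (FractionRing K) x ^ p * ·) h
  have hpow : ∀ z : FractionRing K, z ^ p = ∏ _a : ZMod p, z := fun z => by
    rw [Finset.prod_const, Finset.card_univ, ZMod.card]
  conv_lhs at h => rw [hpow, ← Finset.prod_mul_distrib]
  simp only [map_prod, map_sub, map_mul, map_pow,
    ← IsScalarTower.algebraMap_apply (ZMod p) K (FractionRing K)]
  convert h using 1
  · refine Finset.prod_congr rfl fun a _ => ?_
    field_simp
  · have h1 : algebraMap K (FractionRing K) x ^ p =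
        algebraMap K (FractionRing K) x ^ (p - 1) * algebraMap K (FractionRing K) x := by
      rw [← pow_succ, Nat.sub_add_cancel hp.out.one_le]
    rw [mul_sub, ← mul_pow, mul_div_cancel₀ _ hx', h1]
    field_simp

lemma X_zero_not_dvd_X_one : ¬ (X 0 : MvPolynomial (Fin 2) (ZMod p)) ∣ X 1 := by
  rw [X_zero_dvd_iff, setFirstZero_X_one]
  exact X_ne_zero _

lemma isRelPrime_X_zero_X_one : IsRelPrime (X 0 : MvPolynomial (Fin 2) (ZMod p)) (X 1) :=
  (X_prime (i := 0)).irreducible.isRelPrime_iff_not_dvd.2 X_zero_not_dvd_X_one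

lemma dicksonL_dvd {g : MvPolynomial (Fin 2) (ZMod p)}
    (hg : g ∈ invariantAlg {M : Matrix (Fin 2) (Fin 2) (ZMod p) | M.det = 1}) (h : X 0 ∣ g) :
    dicksonL p ∣ g := by
  have hlin : ∀ a : ZMod p, X 1 - C a * X 0 ∣ g := by
    intro a
    have h1 := map_dvd (polyAct !![-a, 1; -1, 0]) h
    rw [hg _ (by simp)] at h1
    simpa [polyAct_X, smul_eq_C_mul, sub_eq_neg_add] using h1
  have hrel : ∀ a : ZMod p, IsRelPrime (X 0 : MvPolynomial (Fin 2) (ZMod p)) (X 1 - C a * X 0) := by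
    intro a
    have := isRelPrime_X_zero_X_one.add_mul_right_right (-C a : MvPolynomial (Fin 2) (ZMod p))
    simpa [sub_eq_add_neg] using this
  have hprod : ∏ a : ZMod p, (X 1 - C a * X 0) ∣ g := by
    refine Fintype.prod_dvd_of_isRelPrime (fun a b hab => ?_) hlin
    have hu : IsUnit (C (a - b) : MvPolynomial (Fin 2) (ZMod p)) :=
      (sub_ne_zero.2 hab).isUnit.map C
    change IsRelPrime (X 1 - C a * X 0) (X 1 - C b * X 0 : MvPolynomial (Fin 2) (ZMod p))
    have h2 : IsRelPrime (X 1 - C a * X 0) (C (a - b) * X 0 : MvPolynomial (Fin 2) (ZMod p)) :=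
      (isRelPrime_mul_unit_left_right hu).2 (hrel a).symm
    have h3 := h2.add_mul_right_right (1 : MvPolynomial (Fin 2) (ZMod p))
    convert h3 using 1
    rw [C_sub]
    ring
  have hmul : X 0 * ∏ a : ZMod p, (X 1 - C a * X 0) ∣ g :=
    (IsRelPrime.prod_right fun a _ => hrel a).mul_dvd h hprod
  have h1 : ∀ x : MvPolynomial (Fin 2) (ZMod p), x ^ p = x ^ (p - 1) * x := fun x => by
    rw [← pow_succ, Nat.sub_add_cancel hp.out.one_le]
  have heq : dicksonL p = -(X 0 * ∏ a : ZMod p, (X 1 - C a * X 0)) := by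
    have := prod_sub_smul_eq (p := p) (X_ne_zero (0 : Fin 2)) (X 1 : MvPolynomial (Fin 2) (ZMod p))
    rw [algebraMap_eq] at this
    rw [this, dicksonL, h1 (X 0)]
    ring
  rw [heq]
  exact (neg_dvd).2 hmul

lemma exists_dickson_pow {g : MvPolynomial (Fin 2) (ZMod p)}
    (hg : g ∈ invariantAlg {M : Matrix (Fin 2) (Fin 2) (ZMod p) | M.det = 1}) {n : ℕ}
    (hn : g.IsHomogeneous n) :
    ∃ (c : ZMod p) (k : ℕ), (c ≠ 0 → (p - 1) * p * k = n) ∧ X 0 ∣ g - C c * dicksonD p ^ k := by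
  set c : ZMod p := coeff (Finsupp.single 0 n) (setFirstZero (ZMod p) 1 g) with hc
  have hc1 : setFirstZero (ZMod p) 1 g = C c * X 0 ^ n := by
    have h1 := isHomogeneous_setFirstZero hn
    ext d
    have hd : d = Finsupp.single 0 (d 0) := by
      refine Finsupp.ext fun i => ?_
      rw [Subsingleton.elim i 0]
      simp
    rw [coeff_C_mul, coeff_X_pow]
    split_ifs with h
    · rw [mul_one, ← h]
    · rw [mul_zero]
      refine h1.coeff_eq_zero fun h2 => h ?_
      rw [hd] at h2 ⊢
      simp at h2 ⊢
      rw [h2]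
  have hX : X 0 ∣ g - C c * X 1 ^ n := by
    rw [X_zero_dvd_iff, map_sub, hc1]
    simp [setFirstZero]
  by_cases hc0 : c = 0
  · exact ⟨0, 0, by simp, by simpa [hc0] using hX⟩
  have hz : ∀ (a : ZMod p) (k : ℕ),
      X 0 ∣ (C a * X 1 ^ k : MvPolynomial (Fin 2) (ZMod p)) → a = 0 := by
    intro a k h
    rw [X_zero_dvd_iff] at h
    have h2 := congrArg (aeval (fun _ => (1 : ZMod p))) h
    simpa [setFirstZero_X_one, setFirstZero] using h2
  obtain ⟨h, hh⟩ := hX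
  rw [sub_eq_iff_eq_add] at hh
  have hpn : p ∣ n := by
    have h1 : X 0 ∣ pderiv 1 g := by
      refine dvd_pderiv_of_aeval_add_single_eq 1 (X_ne_zero _) ?_
      have h2 := hg !![1, 0; 1, 1] (by simp)
      convert h2 using 2
      refine MvPolynomial.algHom_ext fun i => ?_
      fin_cases i <;> simp [polyAct_X, add_comm]
    rw [hh, X_zero_dvd_iff] at h1
    have h2 := hz (c * n) (n - 1) (by
      rw [X_zero_dvd_iff, ← h1]
      have h3 : pderiv (1 : Fin 2) (X 0 : MvPolynomial (Fin 2) (ZMod p)) = 0 :=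
        pderiv_X_of_ne (by decide)
      simp [h3, setFirstZero, mul_assoc])
    rw [← ZMod.natCast_eq_zero_iff]
    exact (mul_eq_zero.1 h2).resolve_left hc0
  have hpn1 : p - 1 ∣ n := by
    have := FiniteField.forall_pow_eq_one_iff (ZMod p) n
    rw [ZMod.card] at this
    refine this.1 fun x => ?_
    obtain ⟨v, u, hvu, huv⟩ := x
    have h2 := hg !![u, 0; 0, v] (by
      change Matrix.det _ = 1
      rw [Matrix.det_fin_two_of, huv, mul_zero, sub_zero])
    have h3 := hz (c * v ^ n - c) n (by
      rw [X_zero_dvd_iff]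
      have h4 := congrArg (setFirstZero (ZMod p) 1) h2
      rw [hh] at h4
      simp only [map_add, map_mul, map_pow, polyAct_X, smul_eq_C_mul, Fin.sum_univ_two, map_sub,
        setFirstZero_X_zero, setFirstZero_X_one, algHom_C, algebraMap_eq, Matrix.of_apply,
        Matrix.cons_val', Matrix.cons_val_zero, Matrix.cons_val_one, Matrix.cons_val_fin_one,
        map_zero, mul_zero, zero_mul, zero_add, mul_pow] at h4 ⊢
      linear_combination h4)
    have h5 : c * (v ^ n - 1) = 0 := by rw [← h3]; ring
    exact Units.ext (by simpa [sub_eq_zero] using (mul_eq_zero.1 h5).resolve_left hc0)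
  have hdvd : (p - 1) * p ∣ n := by
    refine Nat.Coprime.mul_dvd_of_dvd_of_dvd ?_ hpn1 hpn
    exact (Nat.coprime_self_sub_left hp.out.one_le).2 (Nat.coprime_one_left _)
  obtain ⟨k, rfl⟩ := hdvd
  refine ⟨c, k, fun _ => rfl, ?_⟩
  rw [X_zero_dvd_iff, map_sub, hc1, map_mul, map_pow, setFirstZero_dicksonD, ← pow_mul]
  simp [setFirstZero]

/-- Dickson: the invariants of `SL₂(𝔽_p)` are generated by `dicksonL` and `dicksonD`. -/
lemma invariantAlg_det_eq_one_le :
    invariantAlg {M : Matrix (Fin 2) (Fin 2) (ZMod p) | M.det = 1} ≤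
      Algebra.adjoin (ZMod p) {dicksonL p, dicksonD p} := by
  have hle : Algebra.adjoin (ZMod p) {dicksonL p, dicksonD p} ≤
      invariantAlg {M : Matrix (Fin 2) (Fin 2) (ZMod p) | M.det = 1} :=
    Algebra.adjoin_le (Set.pair_subset dicksonL_mem dicksonD_mem)
  refine invariantAlg_le_of_forall_dvd_sub hle
    (Algebra.subset_adjoin (Set.mem_insert _ _)) ?_ fun n g hg hn => ?_
  · rw [isHomogeneous_dicksonL.totalDegree dicksonL_ne_zero]
    exact Nat.succ_pos _
  · obtain ⟨c, k, hck, hdvd⟩ := exists_dickson_pow hg hn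
    have ha : C c * dicksonD p ^ k ∈ Algebra.adjoin (ZMod p) {dicksonL p, dicksonD p} := by
      rw [← smul_eq_C_mul]
      exact Subalgebra.smul_mem _ (pow_mem (Algebra.subset_adjoin (by simp)) k) c
    refine ⟨_, ha, ?_, dicksonL_dvd (sub_mem hg (hle ha)) hdvd⟩
    by_cases hc : c = 0
    · rw [hc, C_0, zero_mul]
      exact isHomogeneous_zero _ _ _
    · rw [← hck hc]
      exact (isHomogeneous_dicksonD.pow k).C_mul c

end SpecialLinearInvariants

section AffineInvariants

variable {p : ℕ} [hp : Fact p.Prime] {m : ℕ}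

/-- The substitution of the orbit products of `X (i + 1)` under translations by multiples of `X 0`
for `X i`. -/
def orbitProd (p m : ℕ) :
    MvPolynomial (Fin m) (ZMod p) →ₐ[ZMod p] MvPolynomial (Fin (m + 1)) (ZMod p) :=
  MvPolynomial.aeval fun i => X i.succ ^ p - X 0 ^ (p - 1) * X i.succ

lemma orbitProd_X (i : Fin m) :
    orbitProd p m (X i) = X i.succ ^ p - X 0 ^ (p - 1) * X i.succ := by
  simp [orbitProd]

lemma isHomogeneous_orbitProd {f : MvPolynomial (Fin m) (ZMod p)} {n : ℕ}
    (hf : f.IsHomogeneous n) : (orbitProd p m f).IsHomogeneous (p * n) := by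
  refine hf.aeval _ fun i => IsHomogeneous.sub (isHomogeneous_X_pow _ _) ?_
  have := (isHomogeneous_X_pow (R := ZMod p) (0 : Fin (m + 1)) (p - 1)).mul
    (isHomogeneous_X _ i.succ)
  rwa [Nat.sub_add_cancel hp.out.one_le] at this

lemma setFirstZero_orbitProd (f : MvPolynomial (Fin m) (ZMod p)) :
    setFirstZero (ZMod p) m (orbitProd p m f) = f ^ p := by
  have h0 : p - 1 ≠ 0 := Nat.sub_ne_zero_of_lt hp.out.one_lt
  rw [← expand_zmod]
  have : (setFirstZero (ZMod p) m).comp (orbitProd p m) = expand p := by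
    refine MvPolynomial.algHom_ext fun i => ?_
    simp [orbitProd_X, h0]
  exact DFunLike.congr_fun this f

lemma polyAct_X_zero {F : Type u} [Field F] {M : Matrix (Fin (m + 1)) (Fin (m + 1)) F}
    (hM : M 0 = Pi.single 0 1) : polyAct M (X 0) = X 0 := by
  simp [polyAct_X, hM, Pi.single_apply, ite_smul]

lemma setFirstZero_polyAct {F : Type u} [Field F] {M : Matrix (Fin (m + 1)) (Fin (m + 1)) F}
    (hM : M 0 = Pi.single 0 1) (f : MvPolynomial (Fin (m + 1)) F) :
    setFirstZero F m (polyAct M f) =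
      polyAct (M.submatrix Fin.succ Fin.succ) (setFirstZero F m f) := by
  have : (setFirstZero F m).comp (polyAct M) =
      (polyAct (M.submatrix Fin.succ Fin.succ)).comp (setFirstZero F m) := by
    refine MvPolynomial.algHom_ext fun i => ?_
    induction i using Fin.cases with
    | zero => simp [polyAct_X_zero hM]
    | succ i => simp [polyAct_X, Fin.sum_univ_succ]
  exact DFunLike.congr_fun this f

lemma polyAct_orbitProd {M : Matrix (Fin (m + 1)) (Fin (m + 1)) (ZMod p)}
    (hM : M 0 = Pi.single 0 1) (f : MvPolynomial (Fin m) (ZMod p)) :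
    polyAct M (orbitProd p m f) = orbitProd p m (polyAct (M.submatrix Fin.succ Fin.succ) f) := by
  have : (polyAct M).comp (orbitProd p m) =
      (orbitProd p m).comp (polyAct (M.submatrix Fin.succ Fin.succ)) := by
    refine MvPolynomial.algHom_ext fun i => ?_
    have h1 : polyAct M (X i.succ) ^ p = ∑ j, M i.succ j • X j ^ p := by
      simpa [smul_eq_C_mul] using polyAct_X_pow M i.succ 1
    have h2 : (X 0 : MvPolynomial (Fin (m + 1)) (ZMod p)) ^ p = X 0 ^ (p - 1) * X 0 := by
      rw [← pow_succ, Nat.sub_add_cancel hp.out.one_le]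
    have h3 : orbitProd p m (polyAct (M.submatrix Fin.succ Fin.succ) (X i)) =
        ∑ j : Fin m, M i.succ j.succ • X j.succ ^ p -
          X 0 ^ (p - 1) * ∑ j : Fin m, M i.succ j.succ • X j.succ := by
      rw [polyAct_X, map_sum, Finset.mul_sum, ← Finset.sum_sub_distrib]
      refine Finset.sum_congr rfl fun j _ => ?_
      rw [map_smul, orbitProd_X, smul_sub, mul_smul_comm]
      rfl
    rw [AlgHom.comp_apply, AlgHom.comp_apply, h3, orbitProd_X, map_sub, map_mul, map_pow, map_pow,
      polyAct_X_zero hM, h1, polyAct_X, Fin.sum_univ_succ, Fin.sum_univ_succ, h2, mul_add,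
      mul_smul_comm]
    abel
  exact DFunLike.congr_fun this f

lemma det_submatrix_succ {F : Type u} [Field F] {M : Matrix (Fin (m + 1)) (Fin (m + 1)) F}
    (hM : M 0 = Pi.single 0 1) : (M.submatrix Fin.succ Fin.succ).det = M.det := by
  rw [Matrix.det_succ_row_zero, Fin.sum_univ_succ, hM]
  simp [Fin.succAbove_zero]

/-- The matrices of determinant one fixing the first standard basis (row) vector. -/
def affineMatrices (p : ℕ) : Set (Matrix (Fin 3) (Fin 3) (ZMod p)) :=
  {M | M.det = 1 ∧ M 0 = Pi.single 0 1}

lemma orbitProd_mem {f : MvPolynomial (Fin 2) (ZMod p)}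
    (hf : f ∈ invariantAlg {M : Matrix (Fin 2) (Fin 2) (ZMod p) | M.det = 1}) :
    orbitProd p 2 f ∈ invariantAlg (affineMatrices p) := fun M hM => by
  rw [polyAct_orbitProd hM.2, hf]
  exact (det_submatrix_succ hM.2).trans hM.1

/-- Modulo `X 0`, an invariant of the affine group is the `p`-th power of an invariant of
`SL₂(𝔽_p)`. -/
lemma exists_setFirstZero_eq_pow {f : MvPolynomial (Fin 3) (ZMod p)} {n : ℕ}
    (hf : f ∈ invariantAlg (affineMatrices p)) (hn : f.IsHomogeneous n) :
    ∃ g k, g ∈ invariantAlg {M : Matrix (Fin 2) (Fin 2) (ZMod p) | M.det = 1} ∧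
      g.IsHomogeneous k ∧ setFirstZero (ZMod p) 2 f = g ^ p ∧
      (setFirstZero (ZMod p) 2 f ≠ 0 → k * p = n) := by
  obtain ⟨g, k, hg, hgp, hk⟩ := exists_eq_pow_of_pderiv_eq_zero (isHomogeneous_setFirstZero hn) (by
    intro i
    rw [← setFirstZero_pderiv, ← X_zero_dvd_iff]
    refine dvd_pderiv_of_aeval_add_single_eq _ (X_ne_zero _) ?_
    fin_cases i
    · have h2 := hf !![1, 0, 0; 1, 1, 0; 0, 0, 1] ⟨by simp [Matrix.det_fin_three], by
        ext j; fin_cases j <;> rfl⟩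
      convert h2 using 2
      refine MvPolynomial.algHom_ext fun i => ?_
      fin_cases i <;> simp [polyAct_X, Fin.sum_univ_three]
      exact add_comm _ _
    · have h2 := hf !![1, 0, 0; 0, 1, 0; 1, 0, 1] ⟨by simp [Matrix.det_fin_three], by
        ext j; fin_cases j <;> rfl⟩
      convert h2 using 2
      refine MvPolynomial.algHom_ext fun i => ?_
      fin_cases i <;> simp [polyAct_X, Fin.sum_univ_three]
      exact add_comm _ _)
  refine ⟨g, k, fun A (hA : A.det = 1) => ?_, hg, hgp, hk⟩
  let M : Matrix (Fin 3) (Fin 3) (ZMod p) := !![1, 0, 0; 0, A 0 0, A 0 1; 0, A 1 0, A 1 1]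
  have hM0 : M 0 = Pi.single 0 1 := by ext j; fin_cases j <;> rfl
  have hMA : M.submatrix Fin.succ Fin.succ = A := by
    ext i j; fin_cases i <;> fin_cases j <;> rfl
  have h1 := setFirstZero_polyAct hM0 f
  rw [hf M ⟨by rw [← det_submatrix_succ hM0, hMA, hA], hM0⟩, hMA, hgp, map_pow] at h1
  exact (frobenius_inj (MvPolynomial (Fin 2) (ZMod p)) p h1).symm

lemma X_zero_mem : X 0 ∈ invariantAlg (affineMatrices p) := fun _ hM => polyAct_X_zero hM.2

lemma invariantAlg_affineMatrices :
    invariantAlg (affineMatrices p) = Algebra.adjoin (ZMod p)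
      {X 0, orbitProd p 2 (dicksonL p), orbitProd p 2 (dicksonD p)} := by
  have hle : Algebra.adjoin (ZMod p)
      {X 0, orbitProd p 2 (dicksonL p), orbitProd p 2 (dicksonD p)} ≤
      invariantAlg (affineMatrices p) := by
    refine Algebra.adjoin_le ?_
    rintro x (rfl | rfl | rfl)
    · exact X_zero_mem
    · exact orbitProd_mem dicksonL_mem
    · exact orbitProd_mem dicksonD_mem
  refine le_antisymm ?_ hle
  refine invariantAlg_le_of_forall_dvd_sub hle (t := X 0) (Algebra.subset_adjoin (by simp))
    (by rw [totalDegree_X]; exact Nat.one_pos) fun n f hf hn => ?_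
  obtain ⟨g, k, hg, hgk, hfg, hk⟩ := exists_setFirstZero_eq_pow hf hn
  by_cases h0 : setFirstZero (ZMod p) 2 f = 0
  · exact ⟨0, zero_mem _, isHomogeneous_zero _ _ _, by rwa [sub_zero, X_zero_dvd_iff]⟩
  refine ⟨orbitProd p 2 g, ?_, ?_, ?_⟩
  · have h1 : orbitProd p 2 g ∈ (Algebra.adjoin (ZMod p) {dicksonL p, dicksonD p}).map
        (orbitProd p 2) := ⟨g, invariantAlg_det_eq_one_le hg, rfl⟩
    rw [AlgHom.map_adjoin, Set.image_pair] at h1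
    exact Algebra.adjoin_mono (Set.subset_insert _ _) h1
  · rw [← hk h0, mul_comm]
    exact isHomogeneous_orbitProd hgk
  · rw [X_zero_dvd_iff, map_sub, hfg, setFirstZero_orbitProd, sub_self]

lemma algebraicIndependent_pow_char {ι : Type*} {S : Type*} [CommRing S] [IsDomain S]
    [Algebra (ZMod p) S] {s : ι → S} (hs : AlgebraicIndependent (ZMod p) s) :
    AlgebraicIndependent (ZMod p) fun i => s i ^ p := by
  rw [algebraicIndependent_iff] at hs ⊢
  intro q hq
  refine hs q (pow_eq_zero_iff hp.out.ne_zero |>.1 ?_)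
  rw [← map_pow, ← expand_zmod, ← hq, aeval_expand]
  rfl

lemma algebraicIndependent_affine :
    AlgebraicIndependent (ZMod p)
      ![X 0, orbitProd p 2 (dicksonL p), orbitProd p 2 (dicksonD p)] := by
  refine algebraicIndependent_cons_of_map (setFirstZero (ZMod p) 2) (X_ne_zero _)
    setFirstZero_X_zero ?_
  have h1 := algebraicIndependent_pow_char (algebraicIndependent_dickson (p := p))
  have h2 : (fun i => setFirstZero (ZMod p) 2 (![orbitProd p 2 (dicksonL p),
      orbitProd p 2 (dicksonD p)] i)) = fun i => (![dicksonL p, dicksonD p] i) ^ p := by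
    ext1 i
    fin_cases i <;> exact setFirstZero_orbitProd _
  exact h2 ▸ h1

end AffineInvariants

section AffineGroup

variable {p : ℕ} [Fact p.Prime]

lemma one_add_smul_mem {R : Type*} [Ring R] [Algebra (ZMod p) R] (K : Submonoid R) {N : R}
    (hN : N * N = 0) (h : 1 + N ∈ K) (t : ZMod p) : 1 + t • N ∈ K := by
  have key : ∀ n : ℕ, 1 + (n : ZMod p) • N ∈ K := by
    intro n
    induction n with
    | zero => simp
    | succ n ih =>
      convert K.mul_mem ih h using 1
      rw [add_mul, one_mul, mul_add, mul_one, smul_mul_assoc, hN, smul_zero, Nat.cast_succ,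
        add_smul, one_smul]
      abel
  simpa using key t.val

lemma affineMatrices_subset (K : Submonoid (Matrix (Fin 3) (Fin 3) (ZMod p)))
    {s t b₁ b₂ : ZMod p} (hs : s ≠ 0) (ht : t ≠ 0) (hb : b₁ ≠ 0 ∨ b₂ ≠ 0)
    (h₁ : !![1, 0, 0; 0, 1, 0; 0, s, 1] ∈ K) (h₂ : !![1, 0, 0; 0, 1, t; 0, 0, 1] ∈ K)
    (h₃ : !![1, 0, 0; b₁, 1, 0; b₂, 0, 1] ∈ K) : affineMatrices p ⊆ K := by
  have hL : ∀ x : ZMod p, !![1, 0, 0; 0, 1, 0; 0, x, 1] ∈ K := by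
    intro x
    have := one_add_smul_mem K (N := !![0, 0, 0; 0, 0, 0; 0, s, 0])
      (by ext i j; fin_cases i <;> fin_cases j <;> simp [Matrix.mul_apply, Fin.sum_univ_three])
      (by simpa [Matrix.one_fin_three] using h₁) (x / s)
    simpa [Matrix.one_fin_three, hs] using this
  have hU : ∀ x : ZMod p, !![1, 0, 0; 0, 1, x; 0, 0, 1] ∈ K := by
    intro x
    have := one_add_smul_mem K (N := !![0, 0, 0; 0, 0, t; 0, 0, 0])
      (by ext i j; fin_cases i <;> fin_cases j <;> simp [Matrix.mul_apply, Fin.sum_univ_three])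
      (by simpa [Matrix.one_fin_three] using h₂) (x / t)
    simpa [Matrix.one_fin_three, ht] using this
  have hT : ∀ x : ZMod p, !![1, 0, 0; x * b₁, 1, 0; x * b₂, 0, 1] ∈ K := by
    intro x
    have := one_add_smul_mem K (N := !![0, 0, 0; b₁, 0, 0; b₂, 0, 0])
      (by ext i j; fin_cases i <;> fin_cases j <;> simp [Matrix.mul_apply, Fin.sum_univ_three])
      (by simpa [Matrix.one_fin_three] using h₃) x
    simpa [Matrix.one_fin_three] using this
  have hT1 : ∀ x : ZMod p, !![1, 0, 0; x, 1, 0; 0, 0, 1] ∈ K := by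
    intro x
    by_cases hb2 : b₂ = 0
    · have h0 := hT (x / b₁)
      rwa [hb2, mul_zero, div_mul_cancel₀ _ (hb.resolve_right (not_not.2 hb2))] at h0
    · have := K.mul_mem (K.mul_mem (K.mul_mem (hU (x / b₂)) (hT 1)) (hU (-(x / b₂)))) (hT (-1))
      simpa [Matrix.mul_fin_three, hb2] using this
  have hT2 : ∀ x : ZMod p, !![1, 0, 0; 0, 1, 0; x, 0, 1] ∈ K := by
    intro x
    have := K.mul_mem (K.mul_mem (K.mul_mem (hL 1) (hT1 x)) (hL (-1))) (hT1 (-x))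
    simpa [Matrix.mul_fin_three] using this
  have hA : ∀ a b c d : ZMod p, a * d - b * c = 1 → c ≠ 0 →
      !![1, 0, 0; 0, a, b; 0, c, d] ∈ K := by
    intro a b c d hdet hc
    have := K.mul_mem (K.mul_mem (hU ((a - 1) / c)) (hL c)) (hU ((d - 1) / c))
    convert this using 1
    ext i j
    fin_cases i <;> fin_cases j <;> simp [Matrix.mul_apply, Fin.sum_univ_three, hc]
    · field_simp
      linear_combination -hdet
    · field_simp
      ring
  have hA' : ∀ a b c d : ZMod p, a * d - b * c = 1 → !![1, 0, 0; 0, a, b; 0, c, d] ∈ K := by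
    intro a b c d hdet
    by_cases hc : c = 0
    · subst hc
      have ha : a ≠ 0 := by
        rintro rfl
        simp at hdet
      have := K.mul_mem (hL (-1)) (hA a b a (b + d) (by linear_combination hdet) ha)
      simpa [Matrix.mul_fin_three] using this
    · exact hA a b c d hdet hc
  rintro M ⟨hdet, hM⟩
  have hM0 : M 0 0 = 1 := by rw [hM]; rfl
  have hM1 : M 0 1 = 0 := by rw [hM]; rfl
  have hM2 : M 0 2 = 0 := by rw [hM]; rfl
  rw [Matrix.det_fin_three, hM0, hM1, hM2] at hdet
  have := K.mul_mem (K.mul_mem (hT1 (M 1 0)) (hT2 (M 2 0)))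
    (hA' (M 1 1) (M 1 2) (M 2 1) (M 2 2) (by linear_combination hdet))
  rw [Matrix.eta_fin_three M, hM0, hM1, hM2]
  simpa [Matrix.mul_fin_three] using this

end AffineGroup

section Transvections

lemma vecMul_sub_one_vecMul_sub_one {F : Type u} [Field F] {m : ℕ} {M : Matrix (Fin m) (Fin m) F}
    (hM : IsTransvectionMat M) (x : Fin m → F) : (x ᵥ* (M - 1)) ᵥ* (M - 1) = 0 := by
  rw [Matrix.vecMul_vecMul, hM.2, Matrix.vecMul_zero]

lemma vecMul_sub_one {F : Type u} [Field F] {m : ℕ} (M : Matrix (Fin m) (Fin m) F)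
    (x : Fin m → F) : x ᵥ* (M - 1) = x ᵥ* M - x := by
  rw [Matrix.vecMul_sub, Matrix.vecMul_one]

lemma vecMul_sub_one_vecMul {F : Type u} [Field F] {m : ℕ} {M : Matrix (Fin m) (Fin m) F}
    (hM : IsTransvectionMat M) (x : Fin m → F) : (x ᵥ* (M - 1)) ᵥ* M = x ᵥ* (M - 1) := by
  rw [← sub_eq_zero, ← vecMul_sub_one, vecMul_sub_one_vecMul_sub_one hM]

lemma exists_vecMul_sub_one_eq_smul {F : Type u} [Field F] {m : ℕ} {M : Matrix (Fin m) (Fin m) F}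
    (hM : IsTransvectionMat M) {x : Fin m → F} (hx : x ᵥ* (M - 1) ≠ 0) (y : Fin m → F) :
    ∃ s : F, y ᵥ* (M - 1) = s • (x ᵥ* (M - 1)) := by
  have h := hM.1
  rw [← Matrix.rank_transpose, Matrix.rank] at h
  have hmem : ∀ z, z ᵥ* (M - 1) ∈ LinearMap.range (M - 1)ᵀ.mulVecLin := fun z =>
    ⟨z, by rw [Matrix.mulVecLin_apply, Matrix.mulVec_transpose]⟩
  obtain ⟨s, hs⟩ := (finrank_eq_one_iff_of_nonzero' (⟨_, hmem x⟩ : LinearMap.range _)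
    (by simpa [Subtype.ext_iff] using hx)).1 h ⟨_, hmem y⟩
  exact ⟨s, (congrArg Subtype.val hs).symm⟩

lemma vecMul_eq_self_of_mem_span {F : Type u} [Field F] {m : ℕ} {M : Matrix (Fin m) (Fin m) F}
    (hM : IsTransvectionMat M) {v : Fin m → F} (hv : v ᵥ* M ∈ Submodule.span F {v}) :
    v ᵥ* M = v := by
  obtain ⟨a, ha⟩ := Submodule.mem_span_singleton.1 hv
  have h1 : v ᵥ* (M - 1) = (a - 1) • v := by
    rw [vecMul_sub_one, ← ha, sub_smul, one_smul]
  have h2 := vecMul_sub_one_vecMul_sub_one hM v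
  rw [h1, Matrix.smul_vecMul, h1, smul_smul, smul_eq_zero, mul_self_eq_zero] at h2
  rw [← sub_eq_zero, ← vecMul_sub_one, h1]
  rcases h2 with h2 | h2 <;> simp [h2]

lemma vecMul_mem_of_mem_transSubgroup {F : Type u} [Field F] {m : ℕ}
    {G : Subgroup (Matrix.SpecialLinearGroup (Fin m) F)} {U : Submodule F (Fin m → F)}
    (hU : ∀ g ∈ G, IsTransvectionMat (g : Matrix (Fin m) (Fin m) F) →
      ∀ x ∈ U, x ᵥ* ((g : Matrix (Fin m) (Fin m) F) - 1) ∈ U)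
    {τ : Matrix.SpecialLinearGroup (Fin m) F} (hτ : τ ∈ transSubgroup G) :
    ∀ x ∈ U, x ᵥ* (τ : Matrix (Fin m) (Fin m) F) ∈ U := by
  have hg : ∀ g ∈ G, IsTransvectionMat (g : Matrix (Fin m) (Fin m) F) →
      ∀ x ∈ U, x ᵥ* (g : Matrix (Fin m) (Fin m) F) ∈ U := by
    intro g hgG hg x hx
    have := U.add_mem (hU g hgG hg x hx) hx
    rwa [vecMul_sub_one, sub_add_cancel] at this
  induction hτ using Subgroup.closure_induction'' with
  | mem g h => exact hg g h.1 h.2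
  | inv_mem g h =>
    intro x hx
    set y := x ᵥ* ((g⁻¹ : Matrix.SpecialLinearGroup (Fin m) F) : Matrix (Fin m) (Fin m) F)
    have h2 : y ᵥ* (g : Matrix (Fin m) (Fin m) F) = x := by
      rw [Matrix.vecMul_vecMul, ← Matrix.SpecialLinearGroup.coe_mul, inv_mul_cancel,
        Matrix.SpecialLinearGroup.coe_one, Matrix.vecMul_one]
    have h1 := vecMul_sub_one_vecMul h.2 y
    rw [vecMul_sub_one, h2, Matrix.sub_vecMul, h2, ← vecMul_sub_one, eq_sub_iff_add_eq',
      ← eq_sub_iff_add_eq] at h1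
    rw [h1]
    exact U.sub_mem hx (hU g h.1 h.2 x hx)
  | one => simp
  | mul a b _ _ ha hb =>
    intro x hx
    rw [Matrix.SpecialLinearGroup.coe_mul, ← Matrix.vecMul_vecMul]
    exact hb _ (ha x hx)

lemma vecMul_eq_self_of_mem_transSubgroup {F : Type u} [Field F] {m : ℕ}
    {G : Subgroup (Matrix.SpecialLinearGroup (Fin m) F)} {v : Fin m → F}
    (hv : ∀ g ∈ G, v ᵥ* (g : Matrix (Fin m) (Fin m) F) ∈ Submodule.span F {v})
    {τ : Matrix.SpecialLinearGroup (Fin m) F} (hτ : τ ∈ transSubgroup G) :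
    v ᵥ* (τ : Matrix (Fin m) (Fin m) F) = v := by
  induction hτ using Subgroup.closure_induction with
  | mem g h => exact vecMul_eq_self_of_mem_span h.2 (hv g h.1)
  | one => simp
  | mul a b _ _ ha hb =>
    rw [Matrix.SpecialLinearGroup.coe_mul, ← Matrix.vecMul_vecMul, ha, hb]
  | inv a _ ha =>
    conv_lhs => rw [← ha]
    rw [Matrix.vecMul_vecMul, ← Matrix.SpecialLinearGroup.coe_mul, mul_inv_cancel,
      Matrix.SpecialLinearGroup.coe_one, Matrix.vecMul_one]

end Transvections

section Irreducible

variable {p : ℕ} [Fact p.Prime]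

/-- If the transvections of `G` act irreducibly modulo `v₀`, no plane containing `v₀` is stable
under all of them. -/
lemma exists_vecMul_sub_one_notMem {F : Type u} [Field F]
    {G : Subgroup (Matrix.SpecialLinearGroup (Fin 3) F)} {v₀ w : Fin 3 → F}
    (hirr : ∀ U : Submodule F (Fin 3 → F), Submodule.span F {v₀} ≤ U →
      (∀ τ ∈ transSubgroup G, ∀ x ∈ U, x ᵥ* (τ : Matrix (Fin 3) (Fin 3) F) ∈ U) →
      U = Submodule.span F {v₀} ∨ U = ⊤)
    (hw : w ∉ Submodule.span F {v₀}) :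
    ∃ g ∈ G, IsTransvectionMat (g : Matrix (Fin 3) (Fin 3) F) ∧
      ∃ x, x ᵥ* ((g : Matrix (Fin 3) (Fin 3) F) - 1) ∉ Submodule.span F {w, v₀} := by
  classical
  by_contra! h
  rcases hirr (Submodule.span F {w, v₀}) (Submodule.span_mono (Set.subset_insert _ _))
    (fun τ hτ => vecMul_mem_of_mem_transSubgroup (fun g hg hgt x _ => h g hg hgt x) hτ)
    with h1 | h1
  · exact hw (h1 ▸ Submodule.subset_span (Set.mem_insert _ _))
  · have h2 := finrank_span_finset_le_card (R := F) ({w, v₀} : Finset (Fin 3 → F))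
    rw [Set.finrank, Finset.coe_pair, h1, finrank_top, Module.finrank_fin_fun] at h2
    exact absurd (h2.trans Finset.card_le_two) (by decide)

/-- In a suitable basis, the transvections of `G` generate all matrices of determinant one fixing
the first basis vector. -/
lemma exists_basis_transSubgroup {G : Subgroup (Matrix.SpecialLinearGroup (Fin 3) (ZMod p))}
    {v₀ : Fin 3 → ZMod p} (hv₀ : v₀ ≠ 0)
    (hstab : ∀ g ∈ G, v₀ ᵥ* (g : Matrix (Fin 3) (Fin 3) (ZMod p)) ∈
      Submodule.span (ZMod p) ({v₀} : Set (Fin 3 → ZMod p)))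
    (hirr : ∀ U : Submodule (ZMod p) (Fin 3 → ZMod p),
      Submodule.span (ZMod p) ({v₀} : Set (Fin 3 → ZMod p)) ≤ U →
      (∀ τ ∈ transSubgroup G, ∀ x ∈ U, x ᵥ* (τ : Matrix (Fin 3) (Fin 3) (ZMod p)) ∈ U) →
      U = Submodule.span (ZMod p) ({v₀} : Set (Fin 3 → ZMod p)) ∨ U = ⊤)
    (hunfaithful : ∃ τ ∈ transSubgroup G, τ ≠ 1 ∧ ∀ x : Fin 3 → ZMod p,
      x ᵥ* (τ : Matrix (Fin 3) (Fin 3) (ZMod p)) - x ∈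
        Submodule.span (ZMod p) ({v₀} : Set (Fin 3 → ZMod p))) :
    ∃ C : Matrix (Fin 3) (Fin 3) (ZMod p), IsUnit C ∧ C 0 = v₀ ∧
      ∀ M ∈ affineMatrices p, ∃ τ ∈ transSubgroup G,
        C * (τ : Matrix (Fin 3) (Fin 3) (ZMod p)) = M * C := by
  obtain ⟨w, hw⟩ : ∃ w, w ∉ Submodule.span (ZMod p) {v₀} := by
    by_contra! h
    have h1 := finrank_span_singleton (K := ZMod p) hv₀
    rw [(Submodule.eq_top_iff'.2 h : Submodule.span (ZMod p) {v₀} = ⊤), finrank_top,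
      Module.finrank_fin_fun] at h1
    exact absurd h1 (by decide)
  obtain ⟨g, hg, hgt, x, hx⟩ := exists_vecMul_sub_one_notMem hirr hw
  set u := x ᵥ* ((g : Matrix (Fin 3) (Fin 3) (ZMod p)) - 1) with hu
  have hu0 : u ∉ Submodule.span (ZMod p) {v₀} := fun h =>
    hx (Submodule.span_mono (Set.subset_insert _ _) h)
  obtain ⟨g', hg', hgt', x', hx'⟩ := exists_vecMul_sub_one_notMem hirr hu0
  set u' := x' ᵥ* ((g' : Matrix (Fin 3) (Fin 3) (ZMod p)) - 1) with hu'
  have hmem : ∀ {h : Matrix.SpecialLinearGroup (Fin 3) (ZMod p)}, h ∈ G →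
      IsTransvectionMat (h : Matrix (Fin 3) (Fin 3) (ZMod p)) → h ∈ transSubgroup G :=
    fun h1 h2 => Subgroup.subset_closure ⟨h1, h2⟩
  have hfix : ∀ τ ∈ transSubgroup G, v₀ ᵥ* (τ : Matrix (Fin 3) (Fin 3) (ZMod p)) = v₀ :=
    fun τ hτ => vecMul_eq_self_of_mem_transSubgroup hstab hτ
  let C : Matrix (Fin 3) (Fin 3) (ZMod p) := Matrix.of ![v₀, u, u']
  have hC : IsUnit C := by
    rw [← Matrix.linearIndependent_rows_iff_isUnit]
    have h0 : LinearIndependent (ZMod p) ![u, v₀] := linearIndependent_fin2.2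
      ⟨hv₀, fun a ha => hu0 (Submodule.mem_span_singleton.2 ⟨a, ha⟩)⟩
    have h1 : LinearIndependent (ZMod p) ![u', u, v₀] := linearIndependent_finCons.2
      ⟨h0, by rwa [Matrix.range_cons_cons_empty]⟩
    have h2 := h1.comp _ (Fin.rev_injective (n := 3))
    convert h2 using 1
    ext i j
    fin_cases i <;> rfl
  have hcancel : ∀ {A B : Matrix (Fin 3) (Fin 3) (ZMod p)}, C * A = C * B → A = B :=
    fun h => hC.mul_left_cancel h
  let K : Submonoid (Matrix (Fin 3) (Fin 3) (ZMod p)) :=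
    { carrier := {M | ∃ τ ∈ transSubgroup G, C * (τ : Matrix (Fin 3) (Fin 3) (ZMod p)) = M * C}
      one_mem' := ⟨1, one_mem _, by simp⟩
      mul_mem' := by
        rintro M N ⟨τ, hτ, h1⟩ ⟨σ, hσ, h2⟩
        refine ⟨τ * σ, mul_mem hτ hσ, ?_⟩
        rw [Matrix.SpecialLinearGroup.coe_mul, ← mul_assoc, h1, mul_assoc, h2, mul_assoc] }
  have hrows : ∀ A B : Matrix (Fin 3) (Fin 3) (ZMod p), v₀ ᵥ* A = B 0 → u ᵥ* A = B 1 →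
      u' ᵥ* A = B 2 → C * A = B := by
    intro A B h0 h1 h2
    refine funext fun i => ?_
    rw [Matrix.mul_apply_eq_vecMul]
    fin_cases i
    exacts [h0, h1, h2]
  have hKrows : ∀ {τ : Matrix.SpecialLinearGroup (Fin 3) (ZMod p)} {b₁ b₂ s t : ZMod p},
      τ ∈ transSubgroup G → u ᵥ* (τ : Matrix (Fin 3) (Fin 3) (ZMod p)) = b₁ • v₀ + u + t • u' →
      u' ᵥ* (τ : Matrix (Fin 3) (Fin 3) (ZMod p)) = b₂ • v₀ + s • u + u' →
      !![1, 0, 0; b₁, 1, t; b₂, s, 1] ∈ K := by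
    intro τ b₁ b₂ s t hτ h1 h2
    refine ⟨τ, hτ, hrows _ _ ?_ ?_ ?_⟩
    · rw [hfix τ hτ, Matrix.mul_apply_eq_vecMul]
      ext j
      simp [C, Matrix.vecMul, dotProduct, Fin.sum_univ_three]
    · rw [h1, Matrix.mul_apply_eq_vecMul]
      ext j
      simp [C, Matrix.vecMul, dotProduct, Fin.sum_univ_three]
    · rw [h2, Matrix.mul_apply_eq_vecMul]
      ext j
      simp [C, Matrix.vecMul, dotProduct, Fin.sum_univ_three]
  have hne : ∀ {h : Matrix.SpecialLinearGroup (Fin 3) (ZMod p)}, h ∈ transSubgroup G →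
      u ᵥ* (h : Matrix (Fin 3) (Fin 3) (ZMod p)) = u →
      u' ᵥ* (h : Matrix (Fin 3) (Fin 3) (ZMod p)) = u' → h = 1 := by
    intro h hh h1 h2
    refine Subtype.ext (hcancel ?_)
    rw [Matrix.SpecialLinearGroup.coe_one, mul_one]
    exact hrows _ _ (hfix h hh) h1 h2
  have hu_ne : u ≠ 0 := fun h => hu0 (h ▸ zero_mem _)
  have hu'_ne : u' ≠ 0 := fun h => hx' (h ▸ zero_mem _)
  obtain ⟨s, hs⟩ := exists_vecMul_sub_one_eq_smul hgt hu_ne u'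
  obtain ⟨t, ht⟩ := exists_vecMul_sub_one_eq_smul hgt' hu'_ne u
  rw [vecMul_sub_one, sub_eq_iff_eq_add, ← hu] at hs
  rw [vecMul_sub_one, sub_eq_iff_eq_add', ← hu'] at ht
  have hug : u ᵥ* (g : Matrix (Fin 3) (Fin 3) (ZMod p)) = u := vecMul_sub_one_vecMul hgt x
  have hug' : u' ᵥ* (g' : Matrix (Fin 3) (Fin 3) (ZMod p)) = u' := vecMul_sub_one_vecMul hgt' x'
  obtain ⟨τ, hτ, hτ1, hτv⟩ := hunfaithful
  obtain ⟨b₁, hb₁⟩ := Submodule.mem_span_singleton.1 (hτv u)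
  obtain ⟨b₂, hb₂⟩ := Submodule.mem_span_singleton.1 (hτv u')
  rw [eq_comm, sub_eq_iff_eq_add] at hb₁ hb₂
  refine ⟨C, hC, rfl, affineMatrices_subset K (s := s) (t := t) (b₁ := b₁) (b₂ := b₂)
    ?_ ?_ ?_ ?_ ?_ ?_⟩
  · rintro rfl
    rw [zero_smul, zero_add] at hs
    rw [hne (hmem hg hgt) hug hs] at hu
    exact hu_ne (by rw [hu]; simp)
  · rintro rfl
    rw [zero_smul, add_zero] at ht
    rw [hne (hmem hg' hgt') ht hug'] at hu'
    exact hu'_ne (by rw [hu']; simp)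
  · by_contra! hb
    rw [hb.1, zero_smul, zero_add] at hb₁
    rw [hb.2, zero_smul, zero_add] at hb₂
    exact hτ1 (hne hτ hb₁ hb₂)
  · exact hKrows (hmem hg hgt) (by simpa using hug) (by simpa using hs)
  · exact hKrows (hmem hg' hgt') (by simpa using ht) (by simpa using hug')
  · exact hKrows hτ (by simpa using hb₁) (by simpa using hb₂)

end Irreducible

lemma invariantAlg_map_polyAct {F : Type u} [Field F] {m : ℕ} {C D : Matrix (Fin m) (Fin m) F}
    (hCD : C * D = 1) (S : Set (Matrix (Fin m) (Fin m) F)) :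
    (invariantAlg {M | ∃ N ∈ S, C * N = M * C}).map (polyAct C) = invariantAlg S := by
  have hDC : D * C = 1 := mul_eq_one_comm.1 hCD
  apply le_antisymm
  · rintro _ ⟨f, hf, rfl⟩ N hN
    have h1 := hf (C * N * D) ⟨N, hN, by rw [mul_assoc _ D, hDC, mul_one]⟩
    conv_rhs => rw [← h1]
    change polyAct N (polyAct C f) = polyAct C _
    rw [polyAct_polyAct, polyAct_polyAct, mul_assoc _ D, hDC, mul_one]
  · intro f hf
    refine ⟨polyAct D f, ?_, ?_⟩
    · rintro M ⟨N, hN, h⟩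
      rw [polyAct_polyAct]
      have : D * M = N * D := by
        calc D * M = D * (M * C) * D := by rw [mul_assoc, mul_assoc M, hCD, mul_one]
          _ = N * D := by rw [← h, ← mul_assoc, hDC, one_mul]
      rw [this, ← polyAct_polyAct, hf N hN]
    · change polyAct C (polyAct D f) = f
      rw [polyAct_polyAct, hDC, polyAct_one]

/-- If `𝔽_p·v₀` is a 1-dimensional `G`-submodule of `V = 𝔽_p³`,
`G ⊆ SL(V)`, and `V/𝔽_p·v₀` is an irreducible `T(G)`-module on which `T(G)` acts
unfaithfully, then `S(V)^{T(G)}` is a polynomial ring, generated by three algebraically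
independent homogeneous invariants of degrees `1`, `p² + p` and `p³ - p²`. -/
theorem stmt17 (p : ℕ) [Fact p.Prime]
    (G : Subgroup (Matrix.SpecialLinearGroup (Fin 3) (ZMod p)))
    (v₀ : Fin 3 → ZMod p) (hv₀ : v₀ ≠ 0)
    (hstab : ∀ g ∈ G, v₀ ᵥ* (g : Matrix (Fin 3) (Fin 3) (ZMod p)) ∈
      Submodule.span (ZMod p) ({v₀} : Set (Fin 3 → ZMod p)))
    (hirr : ∀ U : Submodule (ZMod p) (Fin 3 → ZMod p),
      Submodule.span (ZMod p) ({v₀} : Set (Fin 3 → ZMod p)) ≤ U →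
      (∀ τ ∈ transSubgroup G, ∀ x ∈ U, x ᵥ* (τ : Matrix (Fin 3) (Fin 3) (ZMod p)) ∈ U) →
      U = Submodule.span (ZMod p) ({v₀} : Set (Fin 3 → ZMod p)) ∨ U = ⊤)
    (hunfaithful : ∃ τ ∈ transSubgroup G, τ ≠ 1 ∧ ∀ x : Fin 3 → ZMod p,
      x ᵥ* (τ : Matrix (Fin 3) (Fin 3) (ZMod p)) - x ∈
        Submodule.span (ZMod p) ({v₀} : Set (Fin 3 → ZMod p))) :
    ∃ f₁ f₂ f₃ : MvPolynomial (Fin 3) (ZMod p),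
      f₁.IsHomogeneous 1 ∧ f₂.IsHomogeneous (p ^ 2 + p) ∧ f₃.IsHomogeneous (p ^ 3 - p ^ 2) ∧
      AlgebraicIndependent (ZMod p) ![f₁, f₂, f₃] ∧
      invariantRing (transSubgroup G) = Algebra.adjoin (ZMod p) {f₁, f₂, f₃} := by
  obtain ⟨C, hC, hC0, hCτ⟩ := exists_basis_transSubgroup hv₀ hstab hirr hunfaithful
  obtain ⟨D, hCD⟩ := hC.exists_right_inv
  have hDC : D * C = 1 := mul_eq_one_comm.1 hCD
  have hp : 1 ≤ p := Fact.out (p := p.Prime).one_le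
  have hinj : Function.Injective (polyAct C) :=
    Function.LeftInverse.injective (g := polyAct D) fun f => by
      rw [polyAct_polyAct, hCD, polyAct_one]
  have hset : {M | ∃ N ∈ {M | ∃ τ ∈ transSubgroup G, (τ : Matrix (Fin 3) (Fin 3) (ZMod p)) = M},
      C * N = M * C} = affineMatrices p := by
    refine Set.Subset.antisymm ?_ fun M hM => ?_
    · rintro M ⟨_, ⟨τ, hτ, rfl⟩, h⟩
      refine ⟨?_, ?_⟩
      · have h1 := congrArg Matrix.det h
        rw [Matrix.det_mul, Matrix.det_mul, τ.2, mul_one] at h1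
        exact (mul_left_eq_self₀.1 h1.symm).resolve_right
          ((Matrix.isUnit_iff_isUnit_det C).1 hC).ne_zero
      · have h1 := congrFun h 0
        rw [Matrix.mul_apply_eq_vecMul, hC0, vecMul_eq_self_of_mem_transSubgroup hstab hτ,
          Matrix.mul_apply_eq_vecMul] at h1
        rw [← Matrix.vecMul_one (M 0), ← hCD, ← Matrix.vecMul_vecMul, ← h1, ← hC0,
          ← Matrix.mul_apply_eq_vecMul, hCD]
        ext j
        simp [Matrix.one_apply, Pi.single_apply, eq_comm]
    · obtain ⟨τ, hτ, h⟩ := hCτ M hM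
      exact ⟨τ, ⟨τ, hτ, rfl⟩, h⟩
  have halg := (algebraicIndependent_affine (p := p)).map' hinj
  refine ⟨polyAct C (X 0), polyAct C (orbitProd p 2 (dicksonL p)),
    polyAct C (orbitProd p 2 (dicksonD p)), isHomogeneous_polyAct C (isHomogeneous_X _ _), ?_, ?_,
    ?_, ?_⟩
  · convert isHomogeneous_polyAct C (isHomogeneous_orbitProd (isHomogeneous_dicksonL (p := p)))
      using 1
    ring
  · convert isHomogeneous_polyAct C (isHomogeneous_orbitProd (isHomogeneous_dicksonD (p := p)))
      using 1
    rw [Nat.sub_mul, Nat.mul_sub]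
    ring_nf
  · convert halg using 1
    ext1 i
    fin_cases i <;> rfl
  · rw [invariantRing, ← invariantAlg_map_polyAct hCD, hset, invariantAlg_affineMatrices,
      AlgHom.map_adjoin, Set.image_insert_eq, Set.image_pair]

end
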